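/- For every ε > 0 there exists d₀ such that for all dimensions d ≥ d₀: limsup_{n→∞} M_d(n)/n ≥ (1 − ε) · log(2/√3) · d · 2^{-d}, where M_d(n) = sup{ |X| : X ⊆ B_n finite with |x − y| > 2 r_d for all distinct x, y ∈ X }. (This quantity limsup_{n→∞} M_d(n)/n equals the maximum sphere packing density θ(d) of ℝ^d, so this is the lower bound θ(d) ≥ (1 + o_d(1)) log(2/√3) · d · 2^{-d}.) -/

import Mathlib

open MeasureTheory Filter

/-- `rd d` is the radius of a Euclidean ball of volume 1 in `ℝ^d`. -/
noncomputable def rd (d : ℕ) : ℝ :=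
  ((volume (Metric.closedBall (0 : EuclideanSpace ℝ (Fin d)) 1)).toReal) ^ (-(1 : ℝ) / d)

/-- The set of `k`-tuples of points of `S` with pairwise distances `> 2 r_d`,
i.e. centers of packings by balls of volume 1. -/
def packSet (d k : ℕ) (S : Set (EuclideanSpace ℝ (Fin d))) :
    Set (Fin k → EuclideanSpace ℝ (Fin d)) :=
  {x | (∀ i, x i ∈ S) ∧ ∀ i j, i ≠ j → dist (x i) (x j) > 2 * rd d}

/-- The canonical hard sphere partition function `Ẑ_S(k)`. -/
noncomputable def Zhat (d : ℕ) (S : Set (EuclideanSpace ℝ (Fin d))) (k : ℕ) : ℝ :=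
  (1 / (Nat.factorial k : ℝ)) *
    ∫ x : Fin k → EuclideanSpace ℝ (Fin d),
      Set.indicator (packSet d k S) (fun _ => (1 : ℝ)) x

/-- The grand canonical hard sphere partition function `Z_S(λ)`. -/
noncomputable def Zgc (d : ℕ) (S : Set (EuclideanSpace ℝ (Fin d))) (lam : ℝ) : ℝ :=
  ∑' k : ℕ, lam ^ k * Zhat d S k

/-- The expected packing density `α_S(λ)` of the hard sphere model. -/
noncomputable def alphaS (d : ℕ) (S : Set (EuclideanSpace ℝ (Fin d))) (lam : ℝ) : ℝ :=
  (∑' k : ℕ, (k : ℝ) * lam ^ k * Zhat d S k) / ((volume S).toReal * Zgc d S lam)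

/-- `Bn d n` is the closed ball of volume `n` centered at the origin in `ℝ^d`. -/
noncomputable def Bn (d : ℕ) (n : ℝ) : Set (EuclideanSpace ℝ (Fin d)) :=
  Metric.closedBall 0 (n ^ ((1 : ℝ) / d) * rd d)

/-- The maximum number of centers of a packing of `B_n` by balls of volume 1. -/
noncomputable def Md (d : ℕ) (n : ℝ) : ℝ :=
  sSup {m : ℝ | ∃ X : Finset (EuclideanSpace ℝ (Fin d)),
    (∀ x ∈ X, x ∈ Bn d n) ∧ (∀ x ∈ X, ∀ y ∈ X, x ≠ y → dist x y > 2 * rd d) ∧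
    m = (X.card : ℝ)}

/-- The externally uncovered region `T(v,X)` for a configuration `X = (x_1,…,x_k)`. -/
def Treg (d : ℕ) (S : Set (EuclideanSpace ℝ (Fin d))) (v : EuclideanSpace ℝ (Fin d))
    {k : ℕ} (x : Fin k → EuclideanSpace ℝ (Fin d)) : Set (EuclideanSpace ℝ (Fin d)) :=
  {p | p ∈ Metric.closedBall v (2 * rd d) ∩ S ∧
    ∀ i, dist (x i) v > 2 * rd d → dist p (x i) > 2 * rd d}

/-- The expectation of a functional `g(v, X)` under the two-part experiment:
`X` drawn from the hard sphere model on `S` at fugacity `λ`, and independently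
`v` uniform in `S`. -/
noncomputable def ExpT (d : ℕ) (S : Set (EuclideanSpace ℝ (Fin d))) (lam : ℝ)
    (g : EuclideanSpace ℝ (Fin d) → ∀ k : ℕ, (Fin k → EuclideanSpace ℝ (Fin d)) → ℝ) : ℝ :=
  (1 / ((volume S).toReal * Zgc d S lam)) *
    ∑' k : ℕ, (lam ^ k / (Nat.factorial k : ℝ)) *
      ∫ v in S, ∫ x : Fin k → EuclideanSpace ℝ (Fin d),
        Set.indicator (packSet d k S) (fun y => g v k y) x

namespace SpherePack

section Comb

variable {α : Type*}

open Classical in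
/-- Independent subsets of `S` for the (reflexive) relation `R`. -/
noncomputable def Ind (R : α → α → Prop) (S : Finset α) : Finset (Finset α) :=
  S.powerset.filter (fun A => ∀ x ∈ A, ∀ y ∈ A, R x y → x = y)

lemma mem_Ind {R : α → α → Prop} {S A : Finset α} :
    A ∈ Ind R S ↔ A ⊆ S ∧ ∀ x ∈ A, ∀ y ∈ A, R x y → x = y := by
  classical
  simp [Ind]

/-- Hard-core partition function. -/
noncomputable def Zf (R : α → α → Prop) (l : ℝ) (S : Finset α) : ℝ :=
  ∑ A ∈ Ind R S, l ^ A.card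

lemma Zf_pos (R : α → α → Prop) {l : ℝ} (hl : 0 < l) (S : Finset α) : 0 < Zf R l S := by
  apply Finset.sum_pos
  · intro A _
    positivity
  · exact ⟨∅, by simp [mem_Ind]⟩

lemma Zf_le (R : α → α → Prop) {l : ℝ} (hl : 0 < l) (S : Finset α) :
    Zf R l S ≤ Real.exp (l * S.card) := by
  classical
  calc Zf R l S ≤ ∑ A ∈ S.powerset, l ^ A.card := by
        apply Finset.sum_le_sum_of_subset_of_nonneg
        · exact Finset.filter_subset _ _
        · intros
          positivity
    _ = (l + 1) ^ S.card := by
        have := Finset.sum_pow_mul_eq_add_pow l 1 S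
        simpa using this
    _ ≤ (Real.exp l) ^ S.card := by
        gcongr
        exact Real.add_one_le_exp l
    _ = Real.exp (l * S.card) := by
        rw [← Real.exp_nat_mul, mul_comm]

open Classical in
lemma pinned (R : α → α → Prop) (hR : ∀ x, R x x) (hs : ∀ x y, R x y → R y x) (l : ℝ)
    (T : Finset α) (u : α) (hu : u ∈ T) :
    ∑ A ∈ (Ind R T).filter (fun A => u ∈ A), l ^ A.card
      = l * ∑ A ∈ (Ind R T).filter (fun A => ∀ a ∈ A, ¬ R u a), l ^ A.card := by
  rw [Finset.mul_sum]
  refine Finset.sum_bij' (fun A _ => A.erase u) (fun A _ => insert u A) ?_ ?_ ?_ ?_ ?_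
  · intro A hA
    simp only [Finset.mem_filter, mem_Ind] at hA ⊢
    obtain ⟨⟨h1, h2⟩, h3⟩ := hA
    refine ⟨⟨(Finset.erase_subset _ _).trans h1, ?_⟩, ?_⟩
    · intro x hx y hy
      exact h2 x (Finset.mem_of_mem_erase hx) y (Finset.mem_of_mem_erase hy)
    · intro a ha h
      exact Finset.ne_of_mem_erase ha (h2 u h3 a (Finset.mem_of_mem_erase ha) h).symm
  · intro A hA
    simp only [Finset.mem_filter, mem_Ind] at hA ⊢
    obtain ⟨⟨h1, h2⟩, h3⟩ := hA
    refine ⟨⟨Finset.insert_subset hu h1, ?_⟩, Finset.mem_insert_self _ _⟩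
    intro x hx y hy hxy
    rcases Finset.mem_insert.1 hx with hx' | hx'
    · rcases Finset.mem_insert.1 hy with hy' | hy'
      · rw [hx', hy']
      · exact absurd (hx' ▸ hxy) (h3 y hy')
    · rcases Finset.mem_insert.1 hy with hy' | hy'
      · exact absurd (hs _ _ (hy' ▸ hxy)) (h3 x hx')
      · exact h2 x hx' y hy' hxy
  · intro A hA
    simp only [Finset.mem_filter] at hA
    exact Finset.insert_erase hA.2
  · intro A hA
    simp only [Finset.mem_filter] at hA
    exact Finset.erase_insert (fun h => hA.2 u h (hR u))
  · intro A hA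
    simp only [Finset.mem_filter] at hA
    rw [← Finset.card_erase_add_one hA.2, pow_succ, mul_comm]

open Classical in
lemma sum_card_eq (R : α → α → Prop) (l : ℝ) (T N : Finset α) :
    ∑ A ∈ Ind R T, l ^ A.card * ((A ∩ N).card : ℝ)
      = ∑ u ∈ N, ∑ A ∈ (Ind R T).filter (fun A => u ∈ A), l ^ A.card := by
  simp_rw [Finset.sum_filter]
  rw [Finset.sum_comm]
  refine Finset.sum_congr rfl fun A hA => ?_
  rw [← Finset.sum_filter, Finset.sum_const, nsmul_eq_mul, mul_comm, Finset.filter_mem_eq_inter,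
    Finset.inter_comm]

open Classical in
lemma local_lemma (R : α → α → Prop) (hR : ∀ x, R x x) (hs : ∀ x y, R x y → R y x) {l K : ℝ}
    (hl : 0 < l) (T : Finset α)
    (hK : ∑ u ∈ T, ((T.filter (fun w => R u w)).card : ℝ) ≤ K * T.card) :
    l * (1 - l * K) * (T.card * Zf R l T) ≤ ∑ A ∈ Ind R T, l ^ A.card * (A.card : ℝ) := by
  have hZ := Zf_pos R hl T
  have e1 : ∑ A ∈ Ind R T, l ^ A.card * (A.card : ℝ)
      = l * ∑ u ∈ T, ∑ A ∈ (Ind R T).filter (fun A => ∀ a ∈ A, ¬ R u a), l ^ A.card := by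
    have : ∑ A ∈ Ind R T, l ^ A.card * (A.card : ℝ)
        = ∑ A ∈ Ind R T, l ^ A.card * ((A ∩ T).card : ℝ) := by
      refine Finset.sum_congr rfl fun A hA => ?_
      rw [Finset.inter_eq_left.2 (mem_Ind.1 hA).1]
    rw [this, sum_card_eq, Finset.mul_sum]
    exact Finset.sum_congr rfl fun u hu => pinned R hR hs l T u hu
  have e2 : ∀ u ∈ T, Zf R l T - (T.filter (fun w => R u w)).card * (l * Zf R l T)
      ≤ ∑ A ∈ (Ind R T).filter (fun A => ∀ a ∈ A, ¬ R u a), l ^ A.card := by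
    intro u hu
    have h1 := Finset.sum_filter_add_sum_filter_not (Ind R T) (fun A => ∀ a ∈ A, ¬ R u a)
      (fun A => l ^ A.card)
    have h2 : ∑ A ∈ (Ind R T).filter (fun A => ¬ ∀ a ∈ A, ¬ R u a), l ^ A.card
        ≤ ∑ a ∈ T.filter (fun w => R u w), ∑ A ∈ (Ind R T).filter (fun A => a ∈ A), l ^ A.card := by
      rw [← sum_card_eq, Finset.sum_filter]
      refine Finset.sum_le_sum fun A hA => ?_
      split_ifs with h
      · positivity
      · push Not at h
        obtain ⟨a, ha, hua⟩ := h
        have : (1 : ℝ) ≤ ((A ∩ T.filter (fun w => R u w)).card : ℝ) := by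
          exact_mod_cast Finset.card_pos.2 ⟨a, by
            simp [ha, hua, (mem_Ind.1 hA).1 ha]⟩
        have hp : 0 < l ^ A.card := by positivity
        nlinarith
    have h3 : ∀ a ∈ T.filter (fun w => R u w),
        ∑ A ∈ (Ind R T).filter (fun A => a ∈ A), l ^ A.card ≤ l * Zf R l T := by
      intro a ha
      rw [pinned R hR hs l T a (Finset.mem_filter.1 ha).1]
      refine mul_le_mul_of_nonneg_left ?_ hl.le
      apply Finset.sum_le_sum_of_subset_of_nonneg
      · exact Finset.filter_subset _ _
      · intros
        positivity
    have h4 := Finset.sum_le_card_nsmul _ _ _ h3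
    rw [nsmul_eq_mul] at h4
    have h5 : Zf R l T = ∑ A ∈ Ind R T, l ^ A.card := rfl
    linarith
  rw [e1, mul_assoc]
  refine mul_le_mul_of_nonneg_left ?_ hl.le
  refine le_trans ?_ (Finset.sum_le_sum e2)
  rw [Finset.sum_sub_distrib, Finset.sum_const, nsmul_eq_mul, ← Finset.sum_mul]
  have := mul_le_mul_of_nonneg_right hK (mul_pos hl hZ).le
  linarith

open Classical in
lemma fiber (R : α → α → Prop) (hs : ∀ x y, R x y → R y x) (l : ℝ)
    (S N : Finset α) (hN : N ⊆ S) (g : Finset α → ℝ) :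
    ∑ I ∈ Ind R S, l ^ I.card * g (I ∩ N)
      = ∑ J ∈ Ind R (S \ N), l ^ J.card *
          ∑ A ∈ Ind R (N.filter (fun u => ∀ j ∈ J, ¬ R u j)), l ^ A.card * g A := by
  simp_rw [Finset.mul_sum]
  rw [Finset.sum_sigma']
  refine Finset.sum_bij' (fun I _ => ⟨I \ N, I ∩ N⟩) (fun p _ => p.1 ∪ p.2) ?_ ?_ ?_ ?_ ?_
  · intro I hI
    obtain ⟨h1, h2⟩ := mem_Ind.1 hI
    simp only [Finset.mem_sigma, mem_Ind]
    refine ⟨⟨Finset.sdiff_subset_sdiff h1 le_rfl, ?_⟩, ?_, ?_⟩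
    · intro x hx y hy
      exact h2 x (Finset.mem_sdiff.1 hx).1 y (Finset.mem_sdiff.1 hy).1
    · intro x hx
      rw [Finset.mem_inter] at hx
      simp only [Finset.mem_filter, hx.2, true_and]
      intro j hj hxj
      rw [Finset.mem_sdiff] at hj
      exact hj.2 (h2 x hx.1 j hj.1 hxj ▸ hx.2)
    · intro x hx y hy
      exact h2 x (Finset.mem_inter.1 hx).1 y (Finset.mem_inter.1 hy).1
  · rintro ⟨J, A⟩ hp
    simp only [Finset.mem_sigma, mem_Ind] at hp ⊢
    obtain ⟨⟨h1, h2⟩, h3, h4⟩ := hp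
    refine ⟨Finset.union_subset (h1.trans Finset.sdiff_subset)
      ((h3.trans (Finset.filter_subset _ _)).trans hN), ?_⟩
    intro x hx y hy hxy
    rcases Finset.mem_union.1 hx with hx | hx
    · rcases Finset.mem_union.1 hy with hy | hy
      · exact h2 x hx y hy hxy
      · exact absurd (hs _ _ hxy) ((Finset.mem_filter.1 (h3 hy)).2 x hx)
    · rcases Finset.mem_union.1 hy with hy | hy
      · exact absurd hxy ((Finset.mem_filter.1 (h3 hx)).2 y hy)
      · exact h4 x hx y hy hxy
  · intro I hI
    exact Finset.sdiff_union_inter I N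
  · rintro ⟨J, A⟩ hp
    simp only [Finset.mem_sigma, mem_Ind] at hp
    obtain ⟨⟨h1, h2⟩, h3, h4⟩ := hp
    have hJ : ∀ x ∈ J, x ∉ N := fun x hx => (Finset.mem_sdiff.1 (h1 hx)).2
    have hA : ∀ x ∈ A, x ∈ N := fun x hx => (Finset.mem_filter.1 (h3 hx)).1
    have a1 : (J ∪ A) \ N = J := by
      ext x
      simp only [Finset.mem_sdiff, Finset.mem_union]
      have := hJ x
      have := hA x
      tauto
    have a2 : (J ∪ A) ∩ N = A := by
      ext x
      simp only [Finset.mem_inter, Finset.mem_union]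
      have := hJ x
      have := hA x
      tauto
    simp only [a1, a2]
  · intro I hI
    simp only
    rw [← mul_assoc, ← pow_add, Finset.card_sdiff_add_card_inter]

open Classical in
/-- Finite-graph version of the Jenssen, Joos and Perkins argument. -/
theorem comb_main (R : α → α → Prop) (hR : ∀ x, R x x) (hs : ∀ x y, R x y → R y x) {l K D w : ℝ}
    (hl : 0 < l) (hlK : l * K < 1) (S : Finset α)
    (hD : ∀ v ∈ S, ((S.filter (fun u => R v u)).card : ℝ) ≤ D)
    (hK : ∀ v ∈ S, ∀ T ⊆ S.filter (fun u => R v u),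
      ∑ u ∈ T, ((T.filter (fun x => R u x)).card : ℝ) ≤ K * T.card) :
    ∃ I ∈ Ind R S, (1 + w) * (S.card : ℝ) ≤ I.card * (Real.exp w / l + D / (1 - l * K)) := by
  set Z := Zf R l S with hZdef
  have hZ : 0 < Z := Zf_pos R hl S
  set c := l * Real.exp (-w) with hc
  have hcpos : 0 < c := by positivity
  have hk : 0 < 1 - l * K := by linarith
  have key : ∀ v ∈ S, c * ((1 + w) * Z -
      (∑ I ∈ Ind R S, l ^ I.card * ((I ∩ S.filter (fun u => R v u)).card : ℝ)) / (1 - l * K))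
      ≤ ∑ A ∈ (Ind R S).filter (fun A => v ∈ A), l ^ A.card := by
    intro v hv
    set N := S.filter (fun u => R v u) with hN
    set T : Finset α → Finset α := fun J => N.filter (fun u => ∀ j ∈ J, ¬ R u j) with hT
    have f1 : Z = ∑ J ∈ Ind R (S \ N), l ^ J.card * Zf R l (T J) := by
      have := fiber R hs l S N (Finset.filter_subset _ _) (fun _ => 1)
      simp only [mul_one] at this
      exact this
    have f2 := fiber R hs l S N (Finset.filter_subset _ _) (fun A => (A.card : ℝ))
    have f3 : l * (1 - l * K) * ∑ J ∈ Ind R (S \ N), l ^ J.card * ((T J).card * Zf R l (T J))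
        ≤ ∑ I ∈ Ind R S, l ^ I.card * ((I ∩ N).card : ℝ) := by
      rw [f2, Finset.mul_sum]
      refine Finset.sum_le_sum fun J hJ => ?_
      have := local_lemma R hR hs hl (T J) (hK v hv (T J) (Finset.filter_subset _ _))
      have hp : 0 < l ^ J.card := by positivity
      have := mul_le_mul_of_nonneg_left this hp.le
      linarith
    have f4 : ∑ A ∈ (Ind R S).filter (fun A => v ∈ A), l ^ A.card
        = l * ∑ J ∈ Ind R (S \ N), l ^ J.card := by
      rw [pinned R hR hs l S v hv]
      congr 1
      refine Finset.sum_congr ?_ fun _ _ => rfl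
      ext J
      simp only [Finset.mem_filter, mem_Ind]
      constructor
      · rintro ⟨⟨h1, h2⟩, h3⟩
        refine ⟨fun x hx => ?_, h2⟩
        rw [Finset.mem_sdiff, hN, Finset.mem_filter]
        exact ⟨h1 hx, fun h => h3 x hx h.2⟩
      · rintro ⟨h1, h2⟩
        refine ⟨⟨h1.trans Finset.sdiff_subset, h2⟩, fun a ha h => ?_⟩
        have := h1 ha
        rw [Finset.mem_sdiff, hN, Finset.mem_filter] at this
        exact this.2 ⟨this.1, h⟩
    have f5 : Real.exp (-w) * ((1 + w) * Z -
        l * ∑ J ∈ Ind R (S \ N), l ^ J.card * ((T J).card * Zf R l (T J)))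
        ≤ ∑ J ∈ Ind R (S \ N), l ^ J.card := by
      rw [f1, Finset.mul_sum, Finset.mul_sum, ← Finset.sum_sub_distrib, Finset.mul_sum]
      refine Finset.sum_le_sum fun J hJ => ?_
      have hp : 0 < l ^ J.card := by positivity
      have hz := Zf_pos R hl (T J)
      have hz2 := Zf_le R hl (T J)
      set t := ((T J).card : ℝ)
      have g1 : Real.exp (-w) * (1 + w - l * t) ≤ Real.exp (-(l * t)) := by
        have := Real.add_one_le_exp (w - l * t)
        calc Real.exp (-w) * (1 + w - l * t) ≤ Real.exp (-w) * Real.exp (w - l * t) := by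
              gcongr
              linarith
          _ = _ := by
              rw [← Real.exp_add]
              congr 1
              ring
      have g2 : Real.exp (-(l * t)) * Zf R l (T J) ≤ 1 := by
        calc Real.exp (-(l * t)) * Zf R l (T J) ≤ Real.exp (-(l * t)) * Real.exp (l * t) := by
              gcongr
          _ = 1 := by
              rw [← Real.exp_add]
              simp
      have g3 : Real.exp (-w) * (1 + w - l * t) * Zf R l (T J) ≤ 1 :=
        (mul_le_mul_of_nonneg_right g1 hz.le).trans g2
      have := mul_le_mul_of_nonneg_left g3 hp.le
      linarith
    rw [f4, hc, mul_assoc]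
    refine mul_le_mul_of_nonneg_left (le_trans ?_ f5) hl.le
    refine mul_le_mul_of_nonneg_left ?_ (Real.exp_pos _).le
    refine sub_le_sub_left ?_ _
    rw [le_div_iff₀ hk]
    linarith
  set E := ∑ A ∈ Ind R S, l ^ A.card * (A.card : ℝ) with hE
  have e1 : E = ∑ v ∈ S, ∑ A ∈ (Ind R S).filter (fun A => v ∈ A), l ^ A.card := by
    rw [← sum_card_eq]
    refine Finset.sum_congr rfl fun A hA => ?_
    rw [Finset.inter_eq_left.2 (mem_Ind.1 hA).1]
  have e2 : ∑ v ∈ S, ∑ I ∈ Ind R S, l ^ I.card * ((I ∩ S.filter (fun u => R v u)).card : ℝ)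
      ≤ D * E := by
    rw [Finset.sum_comm, hE, Finset.mul_sum]
    refine Finset.sum_le_sum fun I hI => ?_
    rw [← Finset.mul_sum]
    have hp : 0 < l ^ I.card := by positivity
    have : ∑ v ∈ S, ((I ∩ S.filter (fun u => R v u)).card : ℝ) ≤ D * I.card := by
      have hIS := (mem_Ind.1 hI).1
      calc ∑ v ∈ S, ((I ∩ S.filter (fun u => R v u)).card : ℝ)
          = ∑ v ∈ S, ∑ u ∈ I, if R v u then (1 : ℝ) else 0 := by
            refine Finset.sum_congr rfl fun v hv => ?_
            rw [← Finset.sum_filter, Finset.sum_const, nsmul_eq_mul, mul_one]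
            congr 2
            ext x
            simp only [Finset.mem_inter, Finset.mem_filter]
            have := @hIS x
            tauto
        _ = ∑ u ∈ I, ∑ v ∈ S, if R v u then (1 : ℝ) else 0 := Finset.sum_comm
        _ = ∑ u ∈ I, ((S.filter (fun v => R u v)).card : ℝ) := by
            refine Finset.sum_congr rfl fun u hu => ?_
            rw [← Finset.sum_filter, Finset.sum_const, nsmul_eq_mul, mul_one]
            congr 2
            ext x
            simp only [Finset.mem_filter]
            exact ⟨fun h => ⟨h.1, hs _ _ h.2⟩, fun h => ⟨h.1, hs _ _ h.2⟩⟩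
        _ ≤ ∑ u ∈ I, D := Finset.sum_le_sum fun u hu => hD u (hIS hu)
        _ = D * I.card := by
            rw [Finset.sum_const, nsmul_eq_mul, mul_comm]
    have := mul_le_mul_of_nonneg_left this hp.le
    linarith
  have e3 : c * ((1 + w) * Z * S.card - D * E / (1 - l * K)) ≤ E := by
    have h := Finset.sum_le_sum key
    rw [← e1, ← Finset.mul_sum, Finset.sum_sub_distrib, Finset.sum_const, nsmul_eq_mul,
      ← Finset.sum_div] at h
    refine le_trans (mul_le_mul_of_nonneg_left ?_ hcpos.le) h
    have := div_le_div_of_nonneg_right e2 hk.le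
    linarith
  have e4 : (1 + w) * S.card * Z ≤ E * (Real.exp w / l + D / (1 - l * K)) := by
    have hcc : Real.exp w / l = 1 / c := by
      rw [hc, Real.exp_neg]
      field_simp
    have h : (1 + w) * Z * S.card - D * E / (1 - l * K) ≤ E / c := by
      rw [le_div_iff₀ hcpos]
      linarith
    rw [hcc]
    have : E * (1 / c + D / (1 - l * K)) = E / c + D * E / (1 - l * K) := by ring
    linarith
  by_contra hcon
  push Not at hcon
  have : E * (Real.exp w / l + D / (1 - l * K)) < (1 + w) * S.card * Z := by
    rw [hE, Finset.sum_mul, hZdef, Zf, Finset.mul_sum]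
    apply Finset.sum_lt_sum_of_nonempty
    · exact ⟨∅, by simp [mem_Ind]⟩
    · intro I hI
      have hp : 0 < l ^ I.card := by positivity
      have := mul_lt_mul_of_pos_left (hcon I hI) hp
      linarith
  linarith

end Comb

section Geom

variable {d : ℕ}

lemma rd_pos (d : ℕ) : 0 < rd d := by
  unfold rd
  apply Real.rpow_pos_of_pos
  apply ENNReal.toReal_pos
  · exact (Metric.measure_closedBall_pos volume _ one_pos).ne'
  · exact measure_closedBall_lt_top.ne

lemma vol_closedBall (hd : 1 ≤ d) (x : EuclideanSpace ℝ (Fin d)) {r : ℝ} (hr : 0 ≤ r) :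
    volume.real (Metric.closedBall x r) = (r / rd d) ^ d := by
  have h1 : volume.real (Metric.closedBall x r)
      = r ^ d * volume.real (Metric.closedBall (0 : EuclideanSpace ℝ (Fin d)) 1) := by
    have := Measure.addHaar_real_closedBall' (volume : Measure (EuclideanSpace ℝ (Fin d))) x hr
    simpa using this
  set ω := volume.real (Metric.closedBall (0 : EuclideanSpace ℝ (Fin d)) 1) with hω
  have hωpos : 0 < ω := by
    apply ENNReal.toReal_pos
    · exact (Metric.measure_closedBall_pos volume _ one_pos).ne'
    · exact measure_closedBall_lt_top.ne
  have h2 : (rd d) ^ d = ω⁻¹ := by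
    have : rd d = ω ^ (-(1 : ℝ) / d) := rfl
    have hd' : (d : ℝ) ≠ 0 := by positivity
    rw [this, ← Real.rpow_natCast, ← Real.rpow_mul hωpos.le, div_mul_cancel₀ _ hd',
      Real.rpow_neg_one]
  rw [h1, div_pow, h2, div_inv_eq_mul]

lemma exists_basis (d : ℕ) {η : ℝ} (hη : 0 < η) :
    ∃ b : Module.Basis (Fin d) ℝ (EuclideanSpace ℝ (Fin d)), ∑ i, ‖b i‖ ≤ η := by
  set δ : ℝ := η / (d + 1) with hδ
  have hδ0 : 0 < δ := by positivity
  refine ⟨(EuclideanSpace.basisFun (Fin d) ℝ).toBasis.unitsSMul (fun _ => Units.mk0 δ hδ0.ne'), ?_⟩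
  have : ∀ i, ‖((EuclideanSpace.basisFun (Fin d) ℝ).toBasis.unitsSMul
      (fun _ => Units.mk0 δ hδ0.ne')) i‖ = δ := by
    intro i
    rw [Module.Basis.unitsSMul_apply, Units.smul_def, norm_smul]
    simp [abs_of_pos hδ0]
  rw [Finset.sum_congr rfl fun i _ => this i]
  simp only [Finset.sum_const, Finset.card_univ, Fintype.card_fin, nsmul_eq_mul]
  rw [hδ, mul_div_assoc', div_le_iff₀ (by positivity)]
  nlinarith

/-- Cells of the lattice. -/
def cell (b : Module.Basis (Fin d) ℝ (EuclideanSpace ℝ (Fin d))) (a : EuclideanSpace ℝ (Fin d)) :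
    Set (EuclideanSpace ℝ (Fin d)) :=
  (fun x => -a + x) ⁻¹' (ZSpan.fundamentalDomain b)

lemma vol_cell (b : Module.Basis (Fin d) ℝ (EuclideanSpace ℝ (Fin d)))
    (a : EuclideanSpace ℝ (Fin d)) :
    volume (cell b a) = volume (ZSpan.fundamentalDomain b) :=
  measure_preimage_add volume (-a) _

lemma meas_cell (b : Module.Basis (Fin d) ℝ (EuclideanSpace ℝ (Fin d)))
    (a : EuclideanSpace ℝ (Fin d)) : MeasurableSet (cell b a) :=
  (ZSpan.fundamentalDomain_measurableSet b).preimage (measurable_const_add (-a))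

lemma norm_of_mem_fd (b : Module.Basis (Fin d) ℝ (EuclideanSpace ℝ (Fin d)))
    {x : EuclideanSpace ℝ (Fin d)} (hx : x ∈ ZSpan.fundamentalDomain b) :
    ‖x‖ ≤ ∑ i, ‖b i‖ := by
  rw [← ZSpan.fract_eq_self.2 hx]
  exact ZSpan.norm_fract_le b x

lemma fd_lt_top (b : Module.Basis (Fin d) ℝ (EuclideanSpace ℝ (Fin d))) :
    volume (ZSpan.fundamentalDomain b) < ⊤ :=
  (ZSpan.fundamentalDomain_isBounded b).measure_lt_top

lemma fd_pos (b : Module.Basis (Fin d) ℝ (EuclideanSpace ℝ (Fin d))) :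
    0 < volume.real (ZSpan.fundamentalDomain b) :=
  ENNReal.toReal_pos (ZSpan.measure_fundamentalDomain_ne_zero b) (fd_lt_top b).ne

lemma cell_disjoint (b : Module.Basis (Fin d) ℝ (EuclideanSpace ℝ (Fin d)))
    {a a' : EuclideanSpace ℝ (Fin d)} (ha : a ∈ Submodule.span ℤ (Set.range b))
    (ha' : a' ∈ Submodule.span ℤ (Set.range b)) (h : a ≠ a') :
    Disjoint (cell b a) (cell b a') := by
  rw [Set.disjoint_left]
  intro x hx hx'
  apply h
  have e1 := ZSpan.fract_eq_self.2 (show -a + x ∈ ZSpan.fundamentalDomain b from hx)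
  have e2 := ZSpan.fract_eq_self.2 (show -a' + x ∈ ZSpan.fundamentalDomain b from hx')
  rw [ZSpan.fract_zSpan_add b x (neg_mem ha)] at e1
  rw [ZSpan.fract_zSpan_add b x (neg_mem ha')] at e2
  have := e1.symm.trans e2
  simpa using this

lemma count_upper (hd : 1 ≤ d) (b : Module.Basis (Fin d) ℝ (EuclideanSpace ℝ (Fin d)))
    {η : ℝ} (hb : ∑ i, ‖b i‖ ≤ η) (A : Finset (EuclideanSpace ℝ (Fin d)))
    (hA : ∀ a ∈ A, a ∈ Submodule.span ℤ (Set.range b)) (c : EuclideanSpace ℝ (Fin d)) {ρ : ℝ}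
    (hρ : 0 ≤ ρ) (hc : ∀ a ∈ A, dist a c ≤ ρ) :
    (A.card : ℝ) * volume.real (ZSpan.fundamentalDomain b) ≤ ((ρ + η) / rd d) ^ d := by
  have hη : 0 ≤ η := le_trans (Finset.sum_nonneg fun i _ => norm_nonneg _) hb
  rw [← vol_closedBall hd c (by linarith)]
  have h1 : volume.real (⋃ a ∈ A, cell b a)
      = (A.card : ℝ) * volume.real (ZSpan.fundamentalDomain b) := by
    rw [measureReal_biUnion_finset (h := fun a _ => by rw [vol_cell]; exact (fd_lt_top b).ne)]
    · simp only [measureReal_def, vol_cell]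
      rw [Finset.sum_const, nsmul_eq_mul]
    · intro a ha a' ha' h
      exact cell_disjoint b (hA a ha) (hA a' ha') h
    · intro a _
      exact meas_cell b a
  rw [← h1]
  apply measureReal_mono _ measure_closedBall_lt_top.ne
  intro x hx
  simp only [Set.mem_iUnion] at hx
  obtain ⟨a, ha, hx⟩ := hx
  have h2 := norm_of_mem_fd b (show -a + x ∈ ZSpan.fundamentalDomain b from hx)
  rw [Metric.mem_closedBall]
  calc dist x c ≤ dist x a + dist a c := dist_triangle _ _ _
    _ ≤ η + ρ := by
      refine add_le_add ?_ (hc a ha)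
      rw [dist_eq_norm, sub_eq_neg_add]
      linarith
    _ = ρ + η := add_comm _ _

lemma count_lower (hd : 1 ≤ d) (b : Module.Basis (Fin d) ℝ (EuclideanSpace ℝ (Fin d)))
    {η : ℝ} (hb : ∑ i, ‖b i‖ ≤ η) (A : Finset (EuclideanSpace ℝ (Fin d))) {ρ : ℝ} (hρ : η ≤ ρ)
    (hA : ∀ a ∈ Submodule.span ℤ (Set.range b), dist a 0 ≤ ρ → a ∈ A) :
    ((ρ - η) / rd d) ^ d ≤ (A.card : ℝ) * volume.real (ZSpan.fundamentalDomain b) := by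
  rw [← vol_closedBall hd 0 (by linarith)]
  have h1 : volume.real (⋃ a ∈ A, cell b a)
      ≤ (A.card : ℝ) * volume.real (ZSpan.fundamentalDomain b) := by
    refine (measureReal_biUnion_finset_le _ _).trans (le_of_eq ?_)
    simp only [measureReal_def, vol_cell]
    rw [Finset.sum_const, nsmul_eq_mul]
  refine le_trans (measureReal_mono ?_ ?_) h1
  · intro x hx
    simp only [Set.mem_iUnion]
    have h2 := ZSpan.norm_fract_le b x
    have h3 := ZSpan.fract_apply b x
    refine ⟨(ZSpan.floor b x : EuclideanSpace ℝ (Fin d)), hA _ (ZSpan.floor b x).2 ?_, ?_⟩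
    · have h4 : (ZSpan.floor b x : EuclideanSpace ℝ (Fin d)) = x - ZSpan.fract b x := by
        rw [h3]
        abel
      rw [h4, dist_zero_right]
      rw [Metric.mem_closedBall, dist_zero_right] at hx
      have := norm_sub_le x (ZSpan.fract b x)
      linarith
    · change -(ZSpan.floor b x : EuclideanSpace ℝ (Fin d)) + x ∈ ZSpan.fundamentalDomain b
      rw [neg_add_eq_sub, ← h3]
      exact ZSpan.fract_mem_fundamentalDomain b x
  · refine ne_of_lt (lt_of_le_of_lt (measure_biUnion_finset_le _ _) ?_)
    simp only [vol_cell]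
    rw [Finset.sum_const, nsmul_eq_mul]
    exact ENNReal.mul_lt_top (ENNReal.natCast_lt_top _) (fd_lt_top b)

lemma mid_dist (v u w : EuclideanSpace ℝ (Fin d)) {r : ℝ} (hr : 0 < r)
    (h1 : dist u v ≤ 2 * r) (h2 : dist u w ≤ 2 * r) (h3 : dist w v ≤ dist u v) :
    dist w (midpoint ℝ u v) ≤ √3 * r := by
  have h := EuclideanGeometry.dist_sq_add_dist_sq_eq_two_mul_dist_midpoint_sq_add_half_dist_sq w u v
  have hs : √3 ^ 2 = 3 := Real.sq_sqrt (by norm_num)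
  rw [dist_comm u w] at h2
  have a1 : dist w v ^ 2 ≤ dist u v ^ 2 := by gcongr
  have a2 : dist w u ^ 2 ≤ (2 * r) ^ 2 := by gcongr
  have a3 : dist u v ^ 2 ≤ (2 * r) ^ 2 := by gcongr
  have a4 : dist w (midpoint ℝ u v) ^ 2 ≤ (√3 * r) ^ 2 := by
    rw [mul_pow, hs]
    nlinarith
  exact le_of_sq_le_sq a4 (by positivity)

open Classical in
lemma pairs_bound (hd : 1 ≤ d) (b : Module.Basis (Fin d) ℝ (EuclideanSpace ℝ (Fin d)))
    {η : ℝ} (hb : ∑ i, ‖b i‖ ≤ η) (T : Finset (EuclideanSpace ℝ (Fin d)))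
    (hT : ∀ a ∈ T, a ∈ Submodule.span ℤ (Set.range b)) (v : EuclideanSpace ℝ (Fin d))
    (hv : ∀ a ∈ T, dist v a ≤ 2 * rd d) :
    ∑ u ∈ T, ((T.filter (fun x => dist u x ≤ 2 * rd d)).card : ℝ)
      ≤ 2 * ((√3 * rd d + η) / rd d) ^ d / volume.real (ZSpan.fundamentalDomain b) * T.card := by
  have hr := rd_pos d
  have hk := fd_pos b
  set B := ((√3 * rd d + η) / rd d) ^ d / volume.real (ZSpan.fundamentalDomain b) with hB
  set f : EuclideanSpace ℝ (Fin d) → EuclideanSpace ℝ (Fin d) → ℝ := fun u x =>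
    if dist u x ≤ 2 * rd d ∧ dist x v ≤ dist u v then 1 else 0 with hf
  have h1 : ∀ u ∈ T, ∑ x ∈ T, f u x ≤ B := by
    intro u hu
    rw [hf]
    simp only
    rw [← Finset.sum_filter, Finset.sum_const, nsmul_eq_mul, mul_one, hB, le_div_iff₀ hk]
    refine count_upper hd b hb _ (fun a ha => hT a (Finset.mem_filter.1 ha).1) (midpoint ℝ u v)
      (by positivity) ?_
    intro a ha
    obtain ⟨_, h2, h3⟩ := Finset.mem_filter.1 ha
    exact mid_dist v u a hr (by rw [dist_comm]; exact hv u hu) h2 h3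
  have h2 : ∑ u ∈ T, ∑ x ∈ T, f u x ≤ B * T.card := by
    have := Finset.sum_le_card_nsmul _ _ _ h1
    rw [nsmul_eq_mul] at this
    linarith
  have h3 : ∑ u ∈ T, ((T.filter (fun x => dist u x ≤ 2 * rd d)).card : ℝ)
      ≤ ∑ u ∈ T, ∑ x ∈ T, (f u x + f x u) := by
    refine Finset.sum_le_sum fun u _ => ?_
    have : ((T.filter (fun x => dist u x ≤ 2 * rd d)).card : ℝ)
        = ∑ x ∈ T, if dist u x ≤ 2 * rd d then (1 : ℝ) else 0 := by
      rw [← Finset.sum_filter, Finset.sum_const, nsmul_eq_mul, mul_one]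
    rw [this]
    refine Finset.sum_le_sum fun x _ => ?_
    simp only [hf, dist_comm x u]
    rcases le_total (dist x v) (dist u v) with h | h
    · by_cases h' : dist u x ≤ 2 * rd d
      · simp only [h', h, and_self, if_true]
        split_ifs <;> norm_num
      · simp [h']
    · by_cases h' : dist u x ≤ 2 * rd d
      · simp only [h', h, and_self, if_true]
        split_ifs <;> norm_num
      · simp [h']
  refine h3.trans ?_
  simp_rw [Finset.sum_add_distrib]
  rw [Finset.sum_comm (f := fun u x => f x u), mul_div_assoc, ← hB]
  linarith

lemma pack_card_le (hd : 1 ≤ d) {n : ℝ} (hn : 0 ≤ n) (X : Finset (EuclideanSpace ℝ (Fin d)))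
    (h1 : ∀ x ∈ X, x ∈ Bn d n) (h2 : ∀ x ∈ X, ∀ y ∈ X, x ≠ y → dist x y > 2 * rd d) :
    (X.card : ℝ) ≤ (n ^ ((1 : ℝ) / d) + 1) ^ d := by
  have hr := rd_pos d
  have hn' : 0 ≤ n ^ ((1 : ℝ) / d) := Real.rpow_nonneg hn _
  have e1 : volume.real (⋃ a ∈ X, Metric.closedBall a (rd d)) = X.card := by
    rw [measureReal_biUnion_finset (h := fun a _ => measure_closedBall_lt_top.ne)]
    · simp_rw [vol_closedBall hd _ hr.le]
      simp [div_self hr.ne']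
    · intro a ha a' ha' h
      apply Metric.closedBall_disjoint_closedBall
      have := h2 a ha a' ha' h
      linarith
    · intro a _
      exact measurableSet_closedBall
  have e2 : (n ^ ((1 : ℝ) / d) + 1) ^ d
      = volume.real (Metric.closedBall (0 : EuclideanSpace ℝ (Fin d))
          ((n ^ ((1 : ℝ) / d) + 1) * rd d)) := by
    rw [vol_closedBall hd _ (by positivity), mul_div_cancel_right₀ _ hr.ne']
  rw [e2, ← e1]
  refine measureReal_mono ?_ measure_closedBall_lt_top.ne
  intro x hx
  simp only [Set.mem_iUnion] at hx
  obtain ⟨a, ha, hx⟩ := hx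
  have h3 := h1 a ha
  rw [Bn, Metric.mem_closedBall] at h3
  rw [Metric.mem_closedBall] at hx ⊢
  have := dist_triangle x a 0
  linarith

lemma card_le_Md (hd : 1 ≤ d) {n : ℝ} (hn : 0 ≤ n) (X : Finset (EuclideanSpace ℝ (Fin d)))
    (h1 : ∀ x ∈ X, x ∈ Bn d n) (h2 : ∀ x ∈ X, ∀ y ∈ X, x ≠ y → dist x y > 2 * rd d) :
    (X.card : ℝ) ≤ Md d n := by
  apply le_csSup
  · refine ⟨(n ^ ((1 : ℝ) / d) + 1) ^ d, ?_⟩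
    rintro m ⟨Y, hY1, hY2, rfl⟩
    exact pack_card_le hd hn Y hY1 hY2
  · exact ⟨X, h1, h2, rfl⟩

lemma Md_le (hd : 1 ≤ d) {n : ℝ} (hn : 0 ≤ n) : Md d n ≤ (n ^ ((1 : ℝ) / d) + 1) ^ d := by
  apply csSup_le
  · exact ⟨0, ∅, by simp⟩
  · rintro m ⟨Y, hY1, hY2, rfl⟩
    exact pack_card_le hd hn Y hY1 hY2

lemma Md_lower_t (hd : 1 ≤ d) {n t l w : ℝ} (hn : 0 < n) (ht : 0 < t)
    (htn : t ≤ n ^ ((1 : ℝ) / d)) (hl : 0 < l) (hlK : l * (2 * (√3 + t) ^ d) < 1) (hw : -1 ≤ w) :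
    (1 + w) * (n ^ ((1 : ℝ) / d) - t) ^ d
      ≤ Md d n * (Real.exp w / l + (2 + t) ^ d / (1 - l * (2 * (√3 + t) ^ d))) := by
  classical
  have hr := rd_pos d
  obtain ⟨b, hb⟩ := exists_basis d (mul_pos ht hr)
  have hk := fd_pos b
  set κ := volume.real (ZSpan.fundamentalDomain b) with hκ
  set s := n ^ ((1 : ℝ) / d) with hs
  have hfin : Set.Finite (Bn d n ∩ (Submodule.span ℤ (Set.range b))) :=
    ZSpan.setFinite_inter b Metric.isBounded_closedBall
  set S := hfin.toFinset with hS
  have hSmem : ∀ x, x ∈ S ↔ dist x 0 ≤ s * rd d ∧ x ∈ Submodule.span ℤ (Set.range b) := by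
    intro x
    rw [hS, Set.Finite.mem_toFinset]
    rfl
  have hlow : (s - t) ^ d ≤ S.card * κ := by
    have := count_lower hd b hb S (ρ := s * rd d) (by gcongr) (fun a ha h => (hSmem a).2 ⟨h, ha⟩)
    rwa [← sub_mul, mul_div_cancel_right₀ _ hr.ne'] at this
  have hlκ : κ * l * (2 * (√3 + t) ^ d / κ) = l * (2 * (√3 + t) ^ d) := by
    field_simp
  obtain ⟨I, hI, hI2⟩ := comb_main (fun x y : EuclideanSpace ℝ (Fin d) => dist x y ≤ 2 * rd d)
    (fun x => by simp [hr.le]) (fun x y h => by rwa [dist_comm])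
    (l := κ * l) (K := 2 * (√3 + t) ^ d / κ) (D := (2 + t) ^ d / κ) (w := w)
    (by positivity) (by rwa [hlκ]) S
    (by
      intro v hv
      rw [le_div_iff₀ hk]
      have := count_upper hd b hb (S.filter (fun u => dist v u ≤ 2 * rd d))
        (fun a ha => ((hSmem a).1 (Finset.mem_filter.1 ha).1).2) v (ρ := 2 * rd d) (by positivity)
        (fun a ha => by rw [dist_comm]; exact (Finset.mem_filter.1 ha).2)
      rwa [← add_mul, mul_div_cancel_right₀ _ hr.ne'] at this)
    (by
      intro v hv T hT
      have := pairs_bound hd b hb T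
        (fun a ha => ((hSmem a).1 (Finset.mem_filter.1 (hT ha)).1).2) v
        (fun a ha => (Finset.mem_filter.1 (hT ha)).2)
      rwa [← add_mul, mul_div_cancel_right₀ _ hr.ne'] at this)
  obtain ⟨hIS, hind⟩ := mem_Ind.1 hI
  have hIM : (I.card : ℝ) ≤ Md d n := by
    apply card_le_Md hd hn.le
    · intro x hx
      exact ((hSmem x).1 (hIS hx)).1
    · intro x hx y hy hxy
      by_contra hcon
      exact hxy (hind x hx y hy (not_lt.1 hcon))
  rw [hlκ] at hI2
  have h1k : 0 < 1 - l * (2 * (√3 + t) ^ d) := by linarith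
  calc (1 + w) * (s - t) ^ d ≤ (1 + w) * (S.card * κ) := by
        gcongr
        linarith
    _ = κ * ((1 + w) * S.card) := by ring
    _ ≤ κ * (I.card * (Real.exp w / (κ * l)
          + (2 + t) ^ d / κ / (1 - l * (2 * (√3 + t) ^ d)))) := by gcongr
    _ = I.card * (Real.exp w / l + (2 + t) ^ d / (1 - l * (2 * (√3 + t) ^ d))) := by
        field_simp
    _ ≤ _ := by gcongr

lemma Md_lower (hd : 1 ≤ d) {n l w : ℝ} (hn : 0 < n) (hl : 0 < l)
    (hlK : l * (2 * √3 ^ d) < 1) (hw : -1 ≤ w) :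
    (1 + w) * n ≤ Md d n * (Real.exp w / l + 2 ^ d / (1 - l * (2 * √3 ^ d))) := by
  set s := n ^ ((1 : ℝ) / d) with hs
  have hs0 : 0 < s := Real.rpow_pos_of_pos hn _
  have hsd : s ^ d = n := by
    have hd' : (d : ℝ) ≠ 0 := by positivity
    rw [hs, ← Real.rpow_natCast, ← Real.rpow_mul hn.le, one_div, inv_mul_cancel₀ hd', Real.rpow_one]
  have c0 : Continuous fun t : ℝ => l * (2 * (√3 + t) ^ d) := by fun_prop
  have t0 : Tendsto (fun t : ℝ => l * (2 * (√3 + t) ^ d)) (nhdsWithin 0 (Set.Ioi 0))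
      (nhds (l * (2 * √3 ^ d))) := by
    have := c0.tendsto 0
    rw [add_zero] at this
    exact this.mono_left nhdsWithin_le_nhds
  have t1 : Tendsto (fun t : ℝ => (1 + w) * (s - t) ^ d) (nhdsWithin 0 (Set.Ioi 0))
      (nhds ((1 + w) * n)) := by
    have : Continuous fun t : ℝ => (1 + w) * (s - t) ^ d := by fun_prop
    have := this.tendsto 0
    rw [sub_zero, hsd] at this
    exact this.mono_left nhdsWithin_le_nhds
  have t2 : Tendsto (fun t : ℝ => (2 + t) ^ d) (nhdsWithin 0 (Set.Ioi 0)) (nhds (2 ^ d)) := by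
    have : Continuous fun t : ℝ => (2 + t) ^ d := by fun_prop
    have := this.tendsto 0
    rw [add_zero] at this
    exact this.mono_left nhdsWithin_le_nhds
  have t3 := ((t2.div (t0.const_sub 1) (by linarith)).const_add (Real.exp w / l)).const_mul (Md d n)
  refine le_of_tendsto_of_tendsto t1 t3 ?_
  have ev1 := t0.eventually (gt_mem_nhds hlK)
  have ev2 : ∀ᶠ t in nhdsWithin (0 : ℝ) (Set.Ioi 0), t < s :=
    (gt_mem_nhds hs0).filter_mono nhdsWithin_le_nhds
  filter_upwards [ev1, ev2, self_mem_nhdsWithin] with t h1 h2 h3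
  exact Md_lower_t hd hn h3 h2.le hl h1 hw

end Geom

end SpherePack

open SpherePack

/-- `θ(d) ≥ (1 + o_d(1)) log(2/√3) d 2^{-d}`. -/
theorem sphere_packing_density_lower_bound :
    ∀ ε : ℝ, 0 < ε → ∃ d₀ : ℕ, ∀ d : ℕ, d₀ ≤ d →
      Filter.limsup (fun n : ℝ => Md d n / n) Filter.atTop
        ≥ (1 - ε) * Real.log (2 / Real.sqrt 3) * d / 2 ^ d := by
  intro ε hε
  set L := Real.log (2 / √3) with hL
  have hs3 : 0 < √3 := by positivity
  have hs32 : √3 < 2 := by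
    rw [Real.sqrt_lt' (by norm_num)]
    norm_num
  have hLpos : 0 < L := Real.log_pos (by rw [lt_div_iff₀ hs3]; linarith)
  -- asymptotics
  have hinv : Tendsto (fun d : ℕ => (1 : ℝ) / d) atTop (nhds 0) :=
    tendsto_one_div_atTop_nhds_zero_nat
  have hlog : Tendsto (fun d : ℕ => Real.log d / d) atTop (nhds 0) := by
    have := (Real.isLittleO_log_id_atTop.tendsto_div_nhds_zero).comp tendsto_natCast_atTop_atTop
    exact this
  have hlim : Tendsto (fun d : ℕ => (1 / (d : ℝ) + (L - 2 * (Real.log d / d)))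
      / (1 / (d : ℝ) + 1 / (1 - 2 * (1 / (d : ℝ))))) atTop (nhds L) := by
    have h1 := hinv.add ((hlog.const_mul 2).const_sub L)
    have h2 := hinv.add ((tendsto_const_nhds (x := (1 : ℝ))).div ((hinv.const_mul 2).const_sub 1)
      (by norm_num))
    have := h1.div h2 (by norm_num)
    rw [show (0 + (L - 2 * 0)) / (0 + 1 / (1 - 2 * 0)) = L by norm_num] at this
    exact this
  have hev1 := hlim.eventually (lt_mem_nhds (show (1 - ε) * L < L by nlinarith))
  have hev2 := (hlog.const_mul 2).eventually (gt_mem_nhds (show 2 * (0 : ℝ) < L by linarith))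
  obtain ⟨d₀, hd₀⟩ := eventually_atTop.1 ((hev1.and hev2).and (eventually_ge_atTop 3))
  refine ⟨d₀, fun d hd => ?_⟩
  obtain ⟨⟨h1, h2⟩, h3⟩ := hd₀ d hd
  have hd1 : 1 ≤ d := by omega
  have hdR : (3 : ℝ) ≤ d := by exact_mod_cast h3
  have hd0 : (0 : ℝ) < d := by linarith
  set w := d * L - 2 * Real.log d with hw
  have hw0 : 0 ≤ w := by
    rw [hw]
    rw [← mul_div_assoc, div_lt_iff₀ hd0] at h2
    linarith
  set l : ℝ := 1 / (√3 ^ d * d) with hl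
  have hl0 : 0 < l := by positivity
  have hlK : l * (2 * √3 ^ d) = 2 * (1 / (d : ℝ)) := by
    rw [hl]
    field_simp
  have hlK1 : 2 * (1 / (d : ℝ)) < 1 := by
    rw [← mul_div_assoc, div_lt_one hd0]
    linarith
  have hew : Real.exp w / l = 2 ^ d * (1 / (d : ℝ)) := by
    have e1 : Real.exp w = (2 / √3) ^ d / d ^ 2 := by
      rw [hw, Real.exp_sub, Real.exp_nat_mul, hL, Real.exp_log (by positivity), two_mul,
        Real.exp_add, Real.exp_log hd0, sq]
    rw [e1, hl, div_pow]
    field_simp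
  have hq : 0 < 1 / (d : ℝ) + 1 / (1 - 2 * (1 / (d : ℝ))) := by
    have : 0 < 1 - 2 * (1 / (d : ℝ)) := by linarith
    positivity
  have hmain : ∀ n : ℝ, 0 < n → (1 - ε) * L * d / 2 ^ d ≤ Md d n / n := by
    intro n hn
    have hM := Md_lower hd1 hn hl0 (by rw [hlK]; exact hlK1) (show -1 ≤ w by linarith)
    rw [hlK, hew] at hM
    rw [lt_div_iff₀ hq] at h1
    rw [div_le_div_iff₀ (by positivity) hn]
    have h4 : d * (1 / (d : ℝ) + (L - 2 * (Real.log d / d))) = 1 + w := by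
      rw [hw]
      field_simp
    have h5 : (1 - ε) * L * d * (1 / (d : ℝ) + 1 / (1 - 2 * (1 / (d : ℝ)))) ≤ 1 + w := by
      rw [← h4]
      have := mul_le_mul_of_nonneg_left h1.le hd0.le
      linarith
    refine le_of_mul_le_mul_right ?_ hq
    calc (1 - ε) * L * d * n * (1 / (d : ℝ) + 1 / (1 - 2 * (1 / (d : ℝ))))
        = (1 - ε) * L * d * (1 / (d : ℝ) + 1 / (1 - 2 * (1 / (d : ℝ)))) * n := by ring
      _ ≤ (1 + w) * n := by gcongr
      _ ≤ _ := hM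
      _ = _ := by ring
  apply le_limsup_of_frequently_le
  · exact (eventually_atTop.2 ⟨1, fun n hn => hmain n (by linarith)⟩).frequently
  · refine ⟨2 ^ d, ?_⟩
    rw [eventually_map]
    filter_upwards [eventually_ge_atTop 1] with n hn
    have hn0 : 0 < n := by linarith
    rw [div_le_iff₀ hn0]
    refine (Md_le hd1 hn0.le).trans ?_
    have hs1 : 1 ≤ n ^ ((1 : ℝ) / d) := Real.one_le_rpow hn (by positivity)
    have hsd : (n ^ ((1 : ℝ) / d)) ^ d = n := by
      rw [← Real.rpow_natCast, ← Real.rpow_mul hn0.le, one_div, inv_mul_cancel₀ hd0.ne',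
        Real.rpow_one]
    calc (n ^ ((1 : ℝ) / d) + 1) ^ d ≤ (2 * n ^ ((1 : ℝ) / d)) ^ d := by
          gcongr
          linarith
      _ = 2 ^ d * n := by rw [mul_pow, hsd]
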